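/- arXiv:2509.06600 — 2 statements merged into one kernel-verified Lean document; each statement's English description precedes it below -/
import Mathlib

section
/- For every i ∈ [N], the total variation distance between the i-th row of P and p satisfies (1/2)·Σ_{j=1}^N |P_{ij} − p_j| = (1/2)·( α_i·(1−p_i) + Σ_{j≠i} α_j·p_j ) ≤ (1−p_i)·max_{j∈[N]} α_j; consequently Σ_{i=1}^N p_i·(1/2)·Σ_{j=1}^N |P_{ij} − p_j| ≤ (max_{j∈[N]} α_j)·Σ_{i=1}^N p_i·(1−p_i). -/
/-- for the transition matrix `P_{ij} = (1-α_j) p_j + α_i 𝟙{i=j}`, the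
total variation distance between the `i`-th row of `P` and `p` satisfies
`(1/2) Σⱼ |P_{ij} - p_j| = (1/2)(α_i (1-p_i) + Σ_{j≠i} α_j p_j) ≤ (1-p_i) maxⱼ α_j`,
and consequently `Σᵢ pᵢ (1/2) Σⱼ |P_{ij} - p_j| ≤ (maxⱼ α_j) Σᵢ pᵢ (1-pᵢ)`. -/
theorem transition_matrix_tv_row_bounds
    (N : ℕ) (hN : 1 ≤ N)
    (p : Fin N → ℝ) (hp : ∀ i, p i ∈ Set.Ioo (0 : ℝ) 1) (hsum : ∑ i, p i = 1)
    (α : Fin N → ℝ) (hα : ∀ i, α i ∈ Set.Ioo (0 : ℝ) 1)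
    (P : Fin N → Fin N → ℝ)
    (hP : ∀ i j, P i j = (1 - α j) * p j + α i * (if i = j then 1 else 0)) :
    (∀ i, (1 / 2) * ∑ j, |P i j - p j|
        = (1 / 2) * (α i * (1 - p i) + ∑ j ∈ Finset.univ.erase i, α j * p j)
      ∧ (1 / 2) * ∑ j, |P i j - p j| ≤ (1 - p i) * (⨆ j, α j))
    ∧ ∑ i, p i * ((1 / 2) * ∑ j, |P i j - p j|) ≤ (⨆ j, α j) * ∑ i, p i * (1 - p i) := by
  have hbdd : ∀ j, α j ≤ ⨆ k, α k := fun j => le_ciSup (Set.finite_range α).bddAbove j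
  have hrow : ∀ i, ∑ j, |P i j - p j|
      = α i * (1 - p i) + ∑ j ∈ Finset.univ.erase i, α j * p j := by
    intro i
    rw [← Finset.add_sum_erase _ _ (Finset.mem_univ i)]
    congr 1
    · have h : P i i - p i = α i * (1 - p i) := by
        rw [hP, if_pos rfl]
        ring
      rw [h, abs_of_nonneg (mul_nonneg (hα i).1.le (sub_nonneg.2 (hp i).2.le))]
    · refine Finset.sum_congr rfl fun j hj => ?_
      have h : P i j - p j = -(α j * p j) := by
        rw [hP, if_neg (Finset.ne_of_mem_erase hj).symm]
        ring
      rw [h, abs_neg, abs_of_nonneg (mul_nonneg (hα j).1.le (hp j).1.le)]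
  have hle : ∀ i, (1 / 2) * ∑ j, |P i j - p j| ≤ (1 - p i) * (⨆ j, α j) := by
    intro i
    have hdiag : α i * (1 - p i) ≤ (⨆ j, α j) * (1 - p i) :=
      mul_le_mul_of_nonneg_right (hbdd i) (sub_nonneg.2 (hp i).2.le)
    have hoff : ∑ j ∈ Finset.univ.erase i, α j * p j ≤ (⨆ j, α j) * (1 - p i) := by
      rw [← hsum, ← Finset.add_sum_erase _ p (Finset.mem_univ i), add_sub_cancel_left,
        Finset.mul_sum]
      exact Finset.sum_le_sum fun j _ => mul_le_mul_of_nonneg_right (hbdd j) (hp j).1.le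
    rw [hrow i]
    linarith
  refine ⟨fun i => ⟨by rw [hrow i], hle i⟩, ?_⟩
  rw [Finset.mul_sum]
  refine Finset.sum_le_sum fun i _ => ?_
  calc p i * ((1 / 2) * ∑ j, |P i j - p j|)
      ≤ p i * ((1 - p i) * ⨆ j, α j) := mul_le_mul_of_nonneg_left (hle i) (hp i).1.le
    _ = (⨆ j, α j) * (p i * (1 - p i)) := by ring
end

section
/- The squared Frobenius norm of the normalized adjacency matrix satisfies ‖â‖_F² ≤ 2·k²/(d_h^{min})² + 2·k·d_h^{max}/(d_h^{min}·d_l^{min}) + 2·m_{ll}/(d_l^{min})². -/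
/-- Degree of node `i`. -/
noncomputable def degree {n : ℕ} (A : Fin n → Fin n → ℝ) (i : Fin n) : ℝ := ∑ j, A i j

/-- Normalized adjacency matrix without self-loops:
`â_{ij} = A_{ij}/√(d_i d_j)` for `i ≠ j` and `â_{ii} = 0`. -/
noncomputable def normAdj0 {n : ℕ} (A : Fin n → Fin n → ℝ) : Fin n → Fin n → ℝ :=
  fun i j => if i = j then 0 else A i j / Real.sqrt (degree A i * degree A j)

/-- A squared entry of `normAdj0` is the adjacency entry over the product of
the degrees, provided `A` is a `0/1` matrix with vanishing diagonal. -/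
lemma normAdj0_sq {n : ℕ} {A : Fin n → Fin n → ℝ} (hA01 : ∀ i j, A i j = 0 ∨ A i j = 1)
    (hAdiag : ∀ i, A i i = 0) (hdeg : ∀ i, 0 ≤ degree A i) (i j : Fin n) :
    normAdj0 A i j ^ 2 = A i j / (degree A i * degree A j) := by
  unfold normAdj0
  split_ifs with h
  · subst h
    simp [hAdiag]
  · rw [div_pow, Real.sq_sqrt (mul_nonneg (hdeg i) (hdeg j))]
    rcases hA01 i j with h | h <;> simp [h]

lemma sum_ite_val_lt_le {n k : ℕ} (hkn : k ≤ n) {f : Fin n → ℝ} {D : ℝ}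
    (hf : ∀ i : Fin n, (i : ℕ) < k → f i ≤ D) :
    ∑ i : Fin n, (if (i : ℕ) < k then f i else 0) ≤ k * D := by
  rw [← Finset.sum_filter]
  refine (Finset.sum_le_card_nsmul _ _ D fun i hi => hf i (by simpa using hi)).trans_eq ?_
  rw [Fin.card_filter_val_lt, min_eq_right hkn, nsmul_eq_mul]

/-- Entrywise bound, split by whether the endpoints are hubs (index below `k`) or leaves. -/
lemma div_mul_le_hub_leaf {n k : ℕ} {A : Fin n → Fin n → ℝ} {d : Fin n → ℝ} {a b : ℝ}
    (hA01 : ∀ i j, A i j = 0 ∨ A i j = 1) (hAsymm : ∀ i j, A i j = A j i)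
    (hAdiag : ∀ i, A i i = 0) (ha : 0 < a) (hb : 0 ≤ b)
    (had : ∀ i : Fin n, (i : ℕ) < k → a ≤ d i)
    (hbd : ∀ i : Fin n, k ≤ (i : ℕ) → 0 < b ∧ b ≤ d i) (i j : Fin n) :
    A i j / (d i * d j) ≤
      (if (i : ℕ) < k then (if (j : ℕ) < k then 1 else 0) else 0) / a ^ 2
      + ((if (i : ℕ) < k then A i j else 0) + (if (j : ℕ) < k then A j i else 0)) / (a * b)
      + ((if i < j ∧ k ≤ (i : ℕ) ∧ k ≤ (j : ℕ) ∧ A i j = 1 then 1 else 0)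
        + (if j < i ∧ k ≤ (j : ℕ) ∧ k ≤ (i : ℕ) ∧ A j i = 1 then 1 else 0)) / b ^ 2 := by
  rcases hA01 i j with h | h
  · have h' : A j i = 0 := hAsymm i j ▸ h
    simp only [h, h', zero_div]
    positivity
  have h' : A j i = 1 := hAsymm i j ▸ h
  have hne : i ≠ j := by
    rintro rfl
    simp [hAdiag] at h
  simp only [h, h', and_true]
  have hd : ∀ i, 0 ≤ d i := fun i => (lt_or_ge (i : ℕ) k).elim
    (fun hi => ha.le.trans (had i hi)) (fun hi => hb.trans (hbd i hi).2)
  have hdi := hd i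
  have hdj := hd j
  rcases lt_or_ge (i : ℕ) k with hi | hi <;> rcases lt_or_ge (j : ℕ) k with hj | hj
  · have h1 : 1 / (d i * d j) ≤ 1 / a ^ 2 := by
      have := had i hi
      have := had j hj
      rw [sq]
      gcongr
    simp only [hi, hj, hi.not_ge, hj.not_ge, if_true, and_false, if_false, add_zero, zero_div]
    have : 0 ≤ (1 + 1) / (a * b) := by positivity
    linarith
  · obtain ⟨hb', hbj⟩ := hbd j hj
    have := had i hi
    have h1 : 1 / (d i * d j) ≤ 1 / (a * b) := by gcongr
    simpa [hi, hj.not_gt, hi.not_ge] using h1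
  · obtain ⟨hb', hbi⟩ := hbd i hi
    have := had j hj
    have h1 : 1 / (d i * d j) ≤ 1 / (a * b) := by
      rw [mul_comm (d i)]
      gcongr
    simpa [hj, hi.not_gt, hj.not_ge] using h1
  · obtain ⟨hb', hbi⟩ := hbd i hi
    obtain ⟨-, hbj⟩ := hbd j hj
    have h1 : 1 / (d i * d j) ≤ 1 / b ^ 2 := by
      rw [sq]
      gcongr
    rcases hne.lt_or_gt with hij | hij <;>
      simpa [hi, hj, hi.not_gt, hj.not_gt, hij, hij.not_gt] using h1

/-- for a hub–leaf graph, the squared Frobenius norm of the normalized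
adjacency matrix satisfies
`‖â‖_F² ≤ 2k²/(d_h^{min})² + 2 k d_h^{max}/(d_h^{min} d_l^{min}) + 2 m_{ll}/(d_l^{min})²`. -/
theorem normalized_adjacency_frobenius_bound
    (n k : ℕ) (hk1 : 1 ≤ k) (hkn : k ≤ n)
    (A : Fin n → Fin n → ℝ)
    (hA01 : ∀ i j, A i j = 0 ∨ A i j = 1)
    (hAsymm : ∀ i j, A i j = A j i)
    (hAdiag : ∀ i, A i i = 0)
    (hdeg : ∀ i, 1 ≤ degree A i) :
    (∑ i, ∑ j, normAdj0 A i j ^ 2)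
      ≤ 2 * (k : ℝ) ^ 2 / (⨅ i : {i : Fin n // (i : ℕ) < k}, degree A i.1) ^ 2
        + 2 * (k : ℝ) * (⨆ i : {i : Fin n // (i : ℕ) < k}, degree A i.1)
          / ((⨅ i : {i : Fin n // (i : ℕ) < k}, degree A i.1)
              * (⨅ i : {i : Fin n // k ≤ (i : ℕ)}, degree A i.1))
        + 2 * ((Finset.univ.filter (fun p : Fin n × Fin n =>
              p.1 < p.2 ∧ k ≤ (p.1 : ℕ) ∧ k ≤ (p.2 : ℕ) ∧ A p.1 p.2 = 1)).card : ℝ)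
          / (⨅ i : {i : Fin n // k ≤ (i : ℕ)}, degree A i.1) ^ 2 := by
  set a := ⨅ i : {i : Fin n // (i : ℕ) < k}, degree A i.1
  set b := ⨅ i : {i : Fin n // k ≤ (i : ℕ)}, degree A i.1
  set D := ⨆ i : {i : Fin n // (i : ℕ) < k}, degree A i.1
  have hdeg0 : ∀ i, 0 ≤ degree A i := fun i => zero_le_one.trans (hdeg i)
  have : Nonempty {i : Fin n // (i : ℕ) < k} := ⟨⟨0, by lia⟩, hk1⟩
  have ha : 0 < a := zero_lt_one.trans_le (le_ciInf fun i => hdeg i)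
  have hb : 0 ≤ b := Real.iInf_nonneg fun i => hdeg0 i
  have had : ∀ i : Fin n, (i : ℕ) < k → a ≤ degree A i := fun i hi =>
    ciInf_le (Set.finite_range _).bddBelow (⟨i, hi⟩ : {i : Fin n // (i : ℕ) < k})
  have hD : ∀ i : Fin n, (i : ℕ) < k → degree A i ≤ D := fun i hi =>
    le_ciSup (f := fun i : {i : Fin n // (i : ℕ) < k} => degree A i.1)
      (Set.finite_range _).bddAbove ⟨i, hi⟩
  have hbd : ∀ i : Fin n, k ≤ (i : ℕ) → 0 < b ∧ b ≤ degree A i := fun i hi => by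
    have : Nonempty {i : Fin n // k ≤ (i : ℕ)} := ⟨i, hi⟩
    exact ⟨zero_lt_one.trans_le (le_ciInf fun i => hdeg i),
      ciInf_le (Set.finite_range _).bddBelow (⟨i, hi⟩ : {i : Fin n // k ≤ (i : ℕ)})⟩
  have hcard : ∑ i : Fin n, ∑ j : Fin n,
      (if i < j ∧ k ≤ (i : ℕ) ∧ k ≤ (j : ℕ) ∧ A i j = 1 then (1 : ℝ) else 0)
      = ((Finset.univ.filter (fun p : Fin n × Fin n =>
          p.1 < p.2 ∧ k ≤ (p.1 : ℕ) ∧ k ≤ (p.2 : ℕ) ∧ A p.1 p.2 = 1)).card : ℝ) := by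
    rw [← Finset.sum_boole, Fintype.sum_prod_type]
  have hhub : ∑ i : Fin n, ∑ j : Fin n,
      (if (i : ℕ) < k then (if (j : ℕ) < k then (1 : ℝ) else 0) else 0) ≤ k * k := by
    rw [Finset.sum_comm]
    refine (Finset.sum_le_sum fun (j : Fin n) _ => sum_ite_val_lt_le hkn
      (f := fun _ => if (j : ℕ) < k then 1 else 0) fun _ _ => le_rfl).trans ?_
    rw [← Finset.mul_sum]
    gcongr
    simpa using sum_ite_val_lt_le hkn (f := fun _ => 1) fun _ _ => le_rfl
  have hmix : ∑ i : Fin n, ∑ j : Fin n, (if (i : ℕ) < k then A i j else 0) ≤ k * D := by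
    refine le_of_eq_of_le (Finset.sum_congr rfl fun i _ => ?_) (sum_ite_val_lt_le hkn hD)
    split_ifs <;> simp [degree]
  set m := ((Finset.univ.filter (fun p : Fin n × Fin n =>
    p.1 < p.2 ∧ k ≤ (p.1 : ℕ) ∧ k ≤ (p.2 : ℕ) ∧ A p.1 p.2 = 1)).card : ℝ)
  calc ∑ i, ∑ j, normAdj0 A i j ^ 2
      ≤ ∑ i, ∑ j, _ := Finset.sum_le_sum fun i _ => Finset.sum_le_sum fun j _ =>
        (normAdj0_sq hA01 hAdiag hdeg0 i j).trans_le
          (div_mul_le_hub_leaf hA01 hAsymm hAdiag ha hb had hbd i j)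
    _ ≤ k * k / a ^ 2 + 2 * (k * D) / (a * b) + 2 * m / b ^ 2 := by
      simp_rw [Finset.sum_add_distrib, ← Finset.sum_div, Finset.sum_add_distrib]
      rw [Finset.sum_comm (f := fun i j : Fin n => if (j : ℕ) < k then A j i else 0),
        Finset.sum_comm (f := fun i j : Fin n =>
          if j < i ∧ k ≤ (j : ℕ) ∧ k ≤ (i : ℕ) ∧ A j i = 1 then (1 : ℝ) else 0), hcard]
      simp only [← two_mul]
      gcongr
    _ ≤ _ := by
      have : (k : ℝ) * k ≤ 2 * k ^ 2 := by nlinarith [sq_nonneg (k : ℝ)]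
      rw [← mul_assoc 2 (k : ℝ) D]
      gcongr
end
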